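/- Let m, n ≥ 2 and let E ⊆ [m] × [n] be C4-free. If P_G(x,y) = Σ_{t=1}^r L_t(x,y)² holds for all x ∈ ℝ^m, y ∈ ℝ^n, where each L_t is an m×n bilinear form, then r ≥ |E|. -/

import Mathlib

lemma bil_eval {m n : ℕ} (c : Fin m → Fin n → ℝ) (i k : Fin m) (j l : Fin n) (p s q u : ℝ) :
    ∑ a, ∑ b, c a b * (Pi.single i p + Pi.single k s : Fin m → ℝ) a *
      (Pi.single j q + Pi.single l u : Fin n → ℝ) b
      = c i j * p * q + c i l * p * u + c k j * s * q + c k l * s * u := by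
  simp only [Pi.add_apply, mul_add, add_mul, Finset.sum_add_distrib, Pi.single_apply,
    mul_ite, ite_mul, mul_zero, zero_mul, Finset.sum_ite_eq', Finset.mem_univ, if_true]
  ring

lemma sq_flip {m : ℕ} (i k : Fin m) (h : i ≠ k) (p s : ℝ) (a : Fin m) :
    ((Pi.single i p + Pi.single k (-s) : Fin m → ℝ) a) ^ 2
      = ((Pi.single i p + Pi.single k s : Fin m → ℝ) a) ^ 2 := by
  simp only [Pi.add_apply, Pi.single_apply]
  split_ifs with h1 h2
  · exact absurd (h1.symm.trans h2) h
  all_goals ring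

/-- If `E ⊆ [m]×[n]` is C4-free and
`P_G(x,y) = Σ_{t=1}^r L_t(x,y)²` with each `L_t` a bilinear form, then `r ≥ |E|`. -/
theorem sos_rank_of_C4_free_lower_bound (m n : ℕ) (hm : 2 ≤ m) (hn : 2 ≤ n)
    (E : Finset (Fin m × Fin n))
    (hC4 : ¬ ∃ (i k : Fin m) (j l : Fin n), i ≠ k ∧ j ≠ l ∧
      (i, j) ∈ E ∧ (i, l) ∈ E ∧ (k, j) ∈ E ∧ (k, l) ∈ E)
    (r : ℕ) (c : Fin r → Fin m → Fin n → ℝ)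
    (hdecomp : ∀ (x : Fin m → ℝ) (y : Fin n → ℝ),
      (∑ e ∈ E, (x e.1) ^ 2 * (y e.2) ^ 2) =
        ∑ t, (∑ i, ∑ j, c t i j * x i * y j) ^ 2) :
    E.card ≤ r := by
  have key : ∀ (i k : Fin m) (j l : Fin n) (p s q u : ℝ),
      (∑ e ∈ E, ((Pi.single i p + Pi.single k s : Fin m → ℝ) e.1) ^ 2 *
        ((Pi.single j q + Pi.single l u : Fin n → ℝ) e.2) ^ 2) =
      ∑ t, (c t i j * p * q + c t i l * p * u + c t k j * s * q + c t k l * s * u) ^ 2 := by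
    intro i k j l p s q u
    rw [hdecomp]
    simp only [bil_eval]
  have hnorm : ∀ i j, ∑ t, (c t i j) ^ 2 = if (i, j) ∈ E then 1 else 0 := by
    intro i j
    have h := key i i j j 1 0 1 0
    simp only [mul_one, mul_zero, add_zero, Pi.single_zero] at h
    rw [← h, ← Finset.sum_ite_eq' E (i, j) (fun _ => (1 : ℝ))]
    refine Finset.sum_congr rfl fun e _ => ?_
    obtain ⟨a, b⟩ := e
    by_cases h1 : a = i <;> by_cases h2 : b = j <;> simp [Pi.single_apply, h1, h2]
  have hzero : ∀ i j, (i, j) ∉ E → ∀ t, c t i j = 0 := by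
    intro i j hij t
    have h := hnorm i j
    rw [if_neg hij, Finset.sum_eq_zero_iff_of_nonneg (fun _ _ => sq_nonneg _)] at h
    exact pow_eq_zero_iff (two_ne_zero) |>.1 (h t (Finset.mem_univ t))
  have hrow : ∀ i j l, j ≠ l → ∑ t, c t i j * c t i l = 0 := by
    intro i j l hjl
    have h1 := key i i j l 1 0 1 1
    have h2 := key i i j l 1 0 1 (-1)
    simp only [sq_flip j l hjl] at h2
    have h3 := h1.symm.trans h2
    rw [← sub_eq_zero, ← Finset.sum_sub_distrib] at h3
    have h4 : (4 : ℝ) * ∑ t, c t i j * c t i l = 0 := by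
      rw [← h3, Finset.mul_sum]
      exact Finset.sum_congr rfl fun t _ => by ring
    linarith
  have hcol : ∀ i k j, i ≠ k → ∑ t, c t i j * c t k j = 0 := by
    intro i k j hik
    have h1 := key i k j j 1 1 1 0
    have h2 := key i k j j 1 (-1) 1 0
    simp only [sq_flip i k hik] at h2
    have h3 := h1.symm.trans h2
    rw [← sub_eq_zero, ← Finset.sum_sub_distrib] at h3
    have h4 : (4 : ℝ) * ∑ t, c t i j * c t k j = 0 := by
      rw [← h3, Finset.mul_sum]
      exact Finset.sum_congr rfl fun t _ => by ring
    linarith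
  have hcross : ∀ i k j l, i ≠ k → j ≠ l →
      ∑ t, (c t i j * c t k l + c t i l * c t k j) = 0 := by
    intro i k j l hik hjl
    have h1 := key i k j l 1 1 1 1
    have h2 := key i k j l 1 (-1) 1 1
    have h3 := key i k j l 1 1 1 (-1)
    have h4 := key i k j l 1 (-1) 1 (-1)
    simp only [sq_flip i k hik, sq_flip j l hjl] at h2 h3 h4
    have h5 := h1.symm.trans h2
    have h6 := h3.symm.trans h4
    rw [← sub_eq_zero, ← Finset.sum_sub_distrib] at h5 h6
    have h7 := congrArg₂ (· - ·) h5 h6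
    simp only [← Finset.sum_sub_distrib] at h7
    have h8 : (8 : ℝ) * ∑ t, (c t i j * c t k l + c t i l * c t k j) = 0 - 0 := by
      rw [← h7, Finset.mul_sum]
      exact Finset.sum_congr rfl fun t _ => by ring
    linarith
  have hon : Orthonormal ℝ (fun e : E => (WithLp.toLp 2 (fun t => c t e.1.1 e.1.2) :
      EuclideanSpace ℝ (Fin r))) := by
    rw [orthonormal_iff_ite]
    rintro ⟨⟨i, j⟩, he⟩ ⟨⟨k, l⟩, hf⟩
    have hin : inner ℝ (WithLp.toLp 2 (fun t => c t i j) : EuclideanSpace ℝ (Fin r))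
        (WithLp.toLp 2 (fun t => c t k l)) = ∑ t, c t i j * c t k l := by
      rw [PiLp.inner_apply]
      exact Finset.sum_congr rfl fun t _ => by simp [mul_comm]
    simp only [hin, Subtype.mk.injEq, Prod.mk.injEq]
    by_cases hik : i = k
    · subst hik
      by_cases hjl : j = l
      · subst hjl
        have h := hnorm i j
        rw [if_pos he] at h
        simpa [← pow_two] using h
      · simpa [hjl] using hrow i j l hjl
    · by_cases hjl : j = l
      · subst hjl
        simpa [hik] using hcol i k j hik
      · rw [if_neg (fun h => hik h.1), ← hcross i k j l hik hjl]
        refine Finset.sum_congr rfl fun t _ => ?_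
        by_cases h1 : (i, l) ∈ E
        · by_cases h2 : (k, j) ∈ E
          · exact absurd ⟨i, k, j, l, hik, hjl, he, h1, h2, hf⟩ hC4
          · simp [hzero k j h2 t]
        · simp [hzero i l h1 t]
  have h := hon.linearIndependent.fintype_card_le_finrank
  simpa using h
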